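/- arXiv:1004.4962 — 10 statements merged into one kernel-verified Lean document; each statement's English description precedes it below -/
import Mathlib

section
/- For b ∈ ℂ, the quadric surface V(b·F₁ + F₂) ⊂ ℙ³(ℂ) is singular — i.e., there exists a nonzero vector v ∈ ℂ⁴ at which all four partial derivatives ∂/∂X, ∂/∂Y, ∂/∂Z, ∂/∂W of b·F₁ + F₂ vanish — if and only if b³ + 4pb − 16q = 0; moreover b³ + 4pb − 16q = (b + 4e₁)(b + 4e₂)(b + 4e₃), so this happens exactly for b ∈ {−4e₁, −4e₂, −4e₃}. -/
open Complex

/-- Fix distinct `e₁ e₂ e₃ : ℂ` with `e₁+e₂+e₃ = 0`, and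
`p = 4(e₁e₂+e₂e₃+e₃e₁)`, `q = -4e₁e₂e₃`.  For `b : ℂ`, the quadric
`V(b·F₁+F₂) ⊂ ℙ³(ℂ)`, where `F₁ = XY - Z²` and `F₂ = 4YZ + pXZ + qX² - W²`,
is singular (all four partial derivatives `∂_X, ∂_Y, ∂_Z, ∂_W` of `b·F₁+F₂`
vanish at some nonzero vector of `ℂ⁴`) iff `b³+4pb-16q = 0`; moreover
`b³+4pb-16q = (b+4e₁)(b+4e₂)(b+4e₃)`, so this happens exactly for
`b ∈ {-4e₁, -4e₂, -4e₃}`. -/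
theorem stmt_0 (e₁ e₂ e₃ : ℂ) (h12 : e₁ ≠ e₂) (h23 : e₂ ≠ e₃) (h13 : e₁ ≠ e₃)
    (hsum : e₁ + e₂ + e₃ = 0) (p q : ℂ)
    (hp : p = 4 * (e₁ * e₂ + e₂ * e₃ + e₃ * e₁)) (hq : q = -4 * (e₁ * e₂ * e₃))
    (b : ℂ) :
    ((∃ X Y Z W : ℂ, ¬ (X = 0 ∧ Y = 0 ∧ Z = 0 ∧ W = 0) ∧
        2 * q * X + b * Y + p * Z = 0 ∧
        b * X + 4 * Z = 0 ∧
        p * X + 4 * Y - 2 * b * Z = 0 ∧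
        -2 * W = 0)
      ↔ b ^ 3 + 4 * p * b - 16 * q = 0)
    ∧ b ^ 3 + 4 * p * b - 16 * q = (b + 4 * e₁) * (b + 4 * e₂) * (b + 4 * e₃)
    ∧ (b ^ 3 + 4 * p * b - 16 * q = 0 ↔ (b = -4 * e₁ ∨ b = -4 * e₂ ∨ b = -4 * e₃)) := by
  have hfactor : b ^ 3 + 4 * p * b - 16 * q = (b + 4 * e₁) * (b + 4 * e₂) * (b + 4 * e₃) := by
    subst hp hq
    linear_combination -4 * b ^ 2 * hsum
  refine ⟨⟨?_, fun hb => ?_⟩, hfactor, ?_⟩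
  · rintro ⟨X, Y, Z, W, hne, hX, hY, hZ, hW⟩
    have hX0 : X ≠ 0 := by
      rintro rfl
      have hZ0 : Z = 0 := by linear_combination hY / 4
      refine hne ⟨rfl, ?_, hZ0, ?_⟩
      · linear_combination hZ / 4 + b / 2 * hZ0
      · linear_combination -hW / 2
    refine (mul_eq_zero.mp ?_).resolve_right hX0
    linear_combination -8 * hX + (2 * p + b ^ 2) * hY + 2 * b * hZ
  · refine ⟨1, -(b ^ 2 / 8 + p / 4), -b / 4, 0, by simp, ?_, by ring, by ring, by ring⟩
    linear_combination -hb / 8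
  · rw [hfactor, mul_eq_zero, mul_eq_zero, or_assoc]
    simp only [add_eq_zero_iff_eq_neg, neg_mul]
end

section
/- For each i ∈ {1,2,3}, writing bᵢ = −4eᵢ, all four partial derivatives of bᵢ·F₁ + F₂ vanish at the vector Qᵢ = (1, −cᵢ, eᵢ, 0) ∈ ℂ⁴ (projectively Qᵢ = (8 : −2p−bᵢ² : −2bᵢ : 0)), and every vector of ℂ⁴ at which they all vanish is a scalar multiple of Qᵢ; similarly, all four partial derivatives of F₁ vanish exactly on the scalar multiples of Q₀ = (0,0,0,1). Hence each of the four singular quadrics of the pencil containing C is an irreducible cone with a unique singular point. -/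
open Complex

/-- With `e : Fin 3 → ℂ` distinct, summing to zero,
`p = 4(e₀e₁+e₁e₂+e₂e₀)`, `q = -4e₀e₁e₂`, and for `i` with the other indices
`i+1, i+2` (cyclically), `bᵢ = -4eᵢ` and `cᵢ = eᵢ² + e_j e_k`:
all four partial derivatives of `bᵢF₁+F₂` (where `F₁ = XY-Z²`,
`F₂ = 4YZ+pXZ+qX²-W²`) vanish at `Qᵢ = (1, -cᵢ, eᵢ, 0)`, which projectively is
`(8 : -2p-bᵢ² : -2bᵢ : 0)`, and every vector where they all vanish is a scalar
multiple of `Qᵢ`; the partial derivatives of `F₁` vanish exactly on the scalar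
multiples of `Q₀ = (0,0,0,1)`. -/
theorem stmt_1 (e : Fin 3 → ℂ) (hinj : Function.Injective e)
    (hsum : e 0 + e 1 + e 2 = 0) (p q : ℂ)
    (hp : p = 4 * (e 0 * e 1 + e 1 * e 2 + e 2 * e 0))
    (hq : q = -4 * (e 0 * e 1 * e 2))
    (i : Fin 3) (b c : ℂ) (hb : b = -4 * e i)
    (hc : c = (e i) ^ 2 + e (i + 1) * e (i + 2)) :
    -- the partials of b·F₁ + F₂ vanish at Qᵢ = (1, -c, eᵢ, 0)
    (2 * q * 1 + b * (-c) + p * (e i) = 0 ∧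
      b * 1 + 4 * (e i) = 0 ∧
      p * 1 + 4 * (-c) - 2 * b * (e i) = 0 ∧
      -2 * (0 : ℂ) = 0)
    -- projectively Qᵢ = (8 : -2p - bᵢ² : -2bᵢ : 0)
    ∧ (-2 * p - b ^ 2 = 8 * (-c) ∧ -2 * b = 8 * e i)
    -- uniqueness up to scalar
    ∧ (∀ X Y Z W : ℂ,
        (2 * q * X + b * Y + p * Z = 0 ∧
          b * X + 4 * Z = 0 ∧
          p * X + 4 * Y - 2 * b * Z = 0 ∧
          -2 * W = 0) →
        ∃ t : ℂ, X = t * 1 ∧ Y = t * (-c) ∧ Z = t * e i ∧ W = t * 0)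
    -- the partials of F₁ vanish exactly on multiples of Q₀ = (0,0,0,1)
    ∧ (∀ X Y Z W : ℂ,
        (Y = 0 ∧ X = 0 ∧ -2 * Z = 0 ∧ (0 : ℂ) = 0) ↔
        ∃ t : ℂ, X = t * 0 ∧ Y = t * 0 ∧ Z = t * 0 ∧ W = t * 1) := by
  have hprod : e i * e (i + 1) * e (i + 2) = e 0 * e 1 * e 2 := by
    fin_cases i
    · rfl
    · change e 1 * e 2 * e 0 = _
      ring
    · change e 2 * e 0 * e 1 = _
      ring
  have hpair : e 0 * e 1 + e 1 * e 2 + e 2 * e 0 = e (i + 1) * e (i + 2) - e i ^ 2 := by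
    fin_cases i
    · change _ = e 1 * e 2 - e 0 ^ 2
      linear_combination e 0 * hsum
    · change _ = e 2 * e 0 - e 1 ^ 2
      linear_combination e 1 * hsum
    · change _ = e 0 * e 1 - e 2 ^ 2
      linear_combination e 2 * hsum
  rw [hpair] at hp
  rw [← hprod] at hq
  subst hp hq hb hc
  refine ⟨⟨by ring, by ring, by ring, by ring⟩, ⟨by ring, by ring⟩, ?_, ?_⟩
  · rintro X Y Z W ⟨-, hY, hZ, hW⟩
    refine ⟨X, by ring, ?_, ?_, ?_⟩
    · linear_combination hZ / 4 - e i / 2 * hY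
    · linear_combination hY / 4
    · linear_combination -hW / 2
  · intro X Y Z W
    constructor
    · rintro ⟨hY, hX, hZ, -⟩
      refine ⟨W, by simpa using hX, by simpa using hY, ?_, by ring⟩
      linear_combination -hZ / 2
    · rintro ⟨t, hX, hY, hZ, -⟩
      simp [hX, hY, hZ]
end

section
/- None of the six lines ℓ₀ᵢ = {Y + cᵢX = Z − eᵢX = 0} (i ∈ {1,2,3}) and ℓᵢⱼ = {c_kX − Y + 2e_kZ = W = 0} ({i,j,k} = {1,2,3}, i < j) meets the curve C: there is no nonzero vector v ∈ ℂ⁴ satisfying F₁(v) = F₂(v) = 0 together with the two linear equations defining one of these lines. -/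
open Complex

theorem sub_mul_sub_eq_of_sum_eq_zero {x y z : ℂ} (h : x + y + z = 0) :
    (x - y) * (x - z) = 2 * x ^ 2 + y * z := by
  linear_combination -x * h

theorem eq_zero_of_mem_curve_of_mem_line_zero {x y z p q X Y Z W : ℂ}
    (h : x + y + z = 0) (hxy : x ≠ y) (hxz : x ≠ z)
    (hF₁ : X * Y - Z ^ 2 = 0)
    (hF₂ : 4 * Y * Z + p * X * Z + q * X ^ 2 - W ^ 2 = 0)
    (hY : Y + (x ^ 2 + y * z) * X = 0) (hZ : Z - x * X = 0) :
    X = 0 ∧ Y = 0 ∧ Z = 0 ∧ W = 0 := by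
  have hX : (x - y) * (x - z) * X ^ 2 = 0 := by
    rw [sub_mul_sub_eq_of_sum_eq_zero h]
    linear_combination X * hY - (Z + x * X) * hZ - hF₁
  obtain rfl : X = 0 := by
    simpa [sub_ne_zero.2 hxy, sub_ne_zero.2 hxz] using hX
  obtain rfl : Y = 0 := by simpa using hY
  obtain rfl : Z = 0 := by simpa using hZ
  simpa using hF₂

theorem eq_zero_of_mem_curve_of_mem_line {x y z X Y Z : ℂ}
    (h : x + y + z = 0) (hxy : x ≠ y) (hxz : x ≠ z) (hyz : y ≠ z)
    (hF₁ : X * Y - Z ^ 2 = 0)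
    (hF₂ : 4 * Y * Z + 4 * (x * y + y * z + z * x) * X * Z + -4 * (x * y * z) * X ^ 2 = 0)
    (hY : (x ^ 2 + y * z) * X - Y + 2 * x * Z = 0) :
    X = 0 ∧ Y = 0 ∧ Z = 0 := by
  have hquad : (x ^ 2 + y * z) * X ^ 2 + 2 * x * X * Z - Z ^ 2 = 0 := by
    linear_combination X * hY + hF₁
  have hcubic : (Z - x * X) * ((Z - y * X) * (Z - z * X)) = 0 := by
    linear_combination X / 4 * hF₂ - Z * hF₁ - X * Z ^ 2 * h
  have hX : X = 0 := by
    rcases mul_eq_zero.1 hcubic with hZ | hZ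
    · obtain rfl : Z = x * X := sub_eq_zero.1 hZ
      have : (x - y) * (x - z) * X ^ 2 = 0 := by
        linear_combination hquad - x * X ^ 2 * h
      simpa [sub_ne_zero.2 hxy, sub_ne_zero.2 hxz] using this
    rcases mul_eq_zero.1 hZ with hZ | hZ
    · obtain rfl : Z = y * X := sub_eq_zero.1 hZ
      have : (y - x) * (y - z) * X ^ 2 = 0 := by
        linear_combination -hquad + x * X ^ 2 * h
      simpa [sub_ne_zero.2 hxy.symm, sub_ne_zero.2 hyz] using this
    · obtain rfl : Z = z * X := sub_eq_zero.1 hZ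
      have : (z - x) * (z - y) * X ^ 2 = 0 := by
        linear_combination -hquad + x * X ^ 2 * h
      simpa [sub_ne_zero.2 hxz.symm, sub_ne_zero.2 hyz.symm] using this
  subst hX
  obtain rfl : Z = 0 := by simpa using hF₁
  exact ⟨rfl, by simpa using hY, rfl⟩

/-- With `e : Fin 3 → ℂ` distinct, summing to zero,
`p = 4(e₀e₁+e₁e₂+e₂e₀)`, `q = -4e₀e₁e₂`, `cᵢ = eᵢ² + e_j e_k`, and
`F₁ = XY - Z²`, `F₂ = 4YZ + pXZ + qX² - W²` cutting out the curve `C`: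
none of the six lines `ℓ₀ᵢ = {Y + cᵢX = Z - eᵢX = 0}` and
`ℓᵢⱼ = {c_kX - Y + 2e_kZ = W = 0}` meets `C`; there is no nonzero vector of
`ℂ⁴` satisfying `F₁ = F₂ = 0` together with the two linear equations defining
one of these lines. -/
theorem stmt_4 (e : Fin 3 → ℂ) (hinj : Function.Injective e)
    (hsum : e 0 + e 1 + e 2 = 0) (p q : ℂ)
    (hp : p = 4 * (e 0 * e 1 + e 1 * e 2 + e 2 * e 0))
    (hq : q = -4 * (e 0 * e 1 * e 2)) (c : Fin 3 → ℂ)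
    (hc : ∀ i : Fin 3, c i = (e i) ^ 2 + e (i + 1) * e (i + 2)) :
    -- the lines ℓ₀ᵢ do not meet C
    (∀ i : Fin 3, ¬ ∃ X Y Z W : ℂ, ¬ (X = 0 ∧ Y = 0 ∧ Z = 0 ∧ W = 0) ∧
        X * Y - Z ^ 2 = 0 ∧
        4 * Y * Z + p * X * Z + q * X ^ 2 - W ^ 2 = 0 ∧
        Y + c i * X = 0 ∧ Z - e i * X = 0)
    -- the lines ℓᵢⱼ (with remaining index k) do not meet C
    ∧ (∀ k : Fin 3, ¬ ∃ X Y Z W : ℂ, ¬ (X = 0 ∧ Y = 0 ∧ Z = 0 ∧ W = 0) ∧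
        X * Y - Z ^ 2 = 0 ∧
        4 * Y * Z + p * X * Z + q * X ^ 2 - W ^ 2 = 0 ∧
        c k * X - Y + 2 * e k * Z = 0 ∧ W = 0) := by
  have h01 : e 0 ≠ e 1 := hinj.ne (by decide)
  have h02 : e 0 ≠ e 2 := hinj.ne (by decide)
  have h12 : e 1 ≠ e 2 := hinj.ne (by decide)
  have hne (i : Fin 3) : e i ≠ e (i + 1) ∧ e i ≠ e (i + 2) ∧ e (i + 1) ≠ e (i + 2) := by
    fin_cases i
    exacts [⟨h01, h02, h12⟩, ⟨h12, h01.symm, h02.symm⟩, ⟨h02.symm, h12.symm, h01⟩]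
  have hsum' (i : Fin 3) : e i + e (i + 1) + e (i + 2) = 0 := by
    fin_cases i
    · exact hsum
    · change e 1 + e 2 + e 0 = 0
      linear_combination hsum
    · change e 2 + e 0 + e 1 = 0
      linear_combination hsum
  have hp' (i : Fin 3) :
      p = 4 * (e i * e (i + 1) + e (i + 1) * e (i + 2) + e (i + 2) * e i) := by
    fin_cases i
    · exact hp
    · change p = 4 * (e 1 * e 2 + e 2 * e 0 + e 0 * e 1)
      linear_combination hp
    · change p = 4 * (e 2 * e 0 + e 0 * e 1 + e 1 * e 2)
      linear_combination hp
  have hq' (i : Fin 3) : q = -4 * (e i * e (i + 1) * e (i + 2)) := by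
    fin_cases i
    · exact hq
    · change q = -4 * (e 1 * e 2 * e 0)
      linear_combination hq
    · change q = -4 * (e 2 * e 0 * e 1)
      linear_combination hq
  constructor
  · rintro i ⟨X, Y, Z, W, hv, hF₁, hF₂, hY, hZ⟩
    rw [hc i] at hY
    exact hv (eq_zero_of_mem_curve_of_mem_line_zero (hsum' i) (hne i).1 (hne i).2.1
      hF₁ hF₂ hY hZ)
  · rintro k ⟨X, Y, Z, W, hv, hF₁, hF₂, hY, rfl⟩
    rw [hc k] at hY
    rw [hp' k, hq' k, zero_pow two_ne_zero, sub_zero] at hF₂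
    obtain ⟨hX, hY', hZ⟩ := eq_zero_of_mem_curve_of_mem_line (hsum' k) (hne k).1
      (hne k).2.1 (hne k).2.2 hF₁ hF₂ hY
    exact hv ⟨hX, hY', hZ, rfl⟩
end

section
/- For each i ∈ {1,2,3}, the rational function uᵢ(x) = (x² + cᵢ)/(x − eᵢ) is invariant under σᵢ and σ₀: if (x,y) ∈ ℂ² satisfies y² = 4(x−e₁)(x−e₂)(x−e₃) and x ≠ eᵢ, and (x',y') = σᵢ(x,y), then (x'² + cᵢ)/(x' − eᵢ) = (x² + cᵢ)/(x − eᵢ); since uᵢ depends only on x, it is also invariant under σ₀(x,y) = (x,−y). Hence uᵢ is invariant under the Klein four-group {id, σ₀, σᵢ, σ₀σᵢ}, so that ℂ(uᵢ) is contained in the fixed field K₀ᵢ of ⟨σ₀, σᵢ⟩ acting on ℂ(x,y). -/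
open Complex

/-- The function `x ↦ (x² + c)/(x - e)` is invariant under the involution
`x ↦ a/(x - e) + e` when `a = e² + c`. -/
theorem div_sub_involution_invariant {K : Type*} [Field K] {e a c x : K}
    (hac : a = e ^ 2 + c) (ha : a ≠ 0) (hx : x ≠ e) :
    ((a / (x - e) + e) ^ 2 + c) / (a / (x - e) + e - e) = (x ^ 2 + c) / (x - e) := by
  have ht : x - e ≠ 0 := sub_ne_zero.mpr hx
  obtain rfl : c = a - e ^ 2 := by rw [hac]; ring
  rw [add_sub_cancel_right]
  field_simp
  ring

/-- With `e : Fin 3 → ℂ` distinct, summing to zero,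
`aᵢ = (eᵢ-e_j)(eᵢ-e_k)` and `cᵢ = eᵢ² + e_j e_k`, the rational function
`uᵢ(x) = (x²+cᵢ)/(x-eᵢ)` is invariant under
`σᵢ(x,y) = (aᵢ/(x-eᵢ)+eᵢ, aᵢy/(x-eᵢ)²)` and `σ₀(x,y) = (x,-y)`:
if `(x,y)` lies on `y² = 4(x-e₁)(x-e₂)(x-e₃)`, `x ≠ eᵢ` and
`(x',y') = σᵢ(x,y)`, then `(x'²+cᵢ)/(x'-eᵢ) = (x²+cᵢ)/(x-eᵢ)`; since `uᵢ`
depends only on `x` it is unchanged by `(x,y) ↦ (x,-y)`, hence `uᵢ` is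
invariant under the whole Klein four-group `{id, σ₀, σᵢ, σ₀σᵢ}` (the value of
`uᵢ` is the same at `(x,y)`, `(x,-y)`, `(x',y')` and `(x',-y')`). -/
theorem stmt_8 (e : Fin 3 → ℂ) (hinj : Function.Injective e)
    (hsum : e 0 + e 1 + e 2 = 0) (a c : Fin 3 → ℂ)
    (ha : ∀ i : Fin 3, a i = (e i - e (i + 1)) * (e i - e (i + 2)))
    (hc : ∀ i : Fin 3, c i = (e i) ^ 2 + e (i + 1) * e (i + 2))
    (i : Fin 3) (x y : ℂ)
    (hcurve : y ^ 2 = 4 * (x - e 0) * (x - e 1) * (x - e 2))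
    (hx : x ≠ e i) (x' y' : ℂ)
    (hx' : x' = a i / (x - e i) + e i)
    (hy' : y' = a i * y / (x - e i) ^ 2) :
    (x' ^ 2 + c i) / (x' - e i) = (x ^ 2 + c i) / (x - e i) := by
  have ha₀ : a i ≠ 0 := by
    rw [ha]
    refine mul_ne_zero (sub_ne_zero.mpr (hinj.ne ?_)) (sub_ne_zero.mpr (hinj.ne ?_)) <;>
      fin_cases i <;> decide
  have hsum' : e i + e (i + 1) + e (i + 2) = 0 := by
    rw [← hsum]
    fin_cases i <;> simp <;> ring
  have hac : a i = e i ^ 2 + c i := by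
    rw [ha, hc]
    linear_combination -e i * hsum'
  rw [hx']
  exact div_sub_involution_invariant hac ha₀ hx
end

section
/- Fix i ∈ {1,2,3}. If x₁, x₂ ∈ ℂ∖{eᵢ} satisfy (x₁² + cᵢ)/(x₁ − eᵢ) = (x₂² + cᵢ)/(x₂ − eᵢ), then either x₂ = x₁ or (x₁ − eᵢ)(x₂ − eᵢ) = aᵢ. Consequently, if (x₁,y₁) satisfies y₁² = 4(x₁−e₁)(x₁−e₂)(x₁−e₃) with x₁ ≠ eᵢ, then the set of points (x₂,y₂) with y₂² = 4(x₂−e₁)(x₂−e₂)(x₂−e₃), x₂ ≠ eᵢ, and (x₂²+cᵢ)/(x₂−eᵢ) = (x₁²+cᵢ)/(x₁−eᵢ) is exactly the ⟨σ₀,σᵢ⟩-orbit {(x₁, y₁), (x₁, −y₁), (x₁', y₁'), (x₁', −y₁')}, where x₁' = aᵢ/(x₁−eᵢ) + eᵢ and y₁' = aᵢ·y₁/(x₁−eᵢ)². -/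
open Complex

section TwoTorsionTranslation

variable {K : Type*} [Field K] {p q r : K}

/-- Two points off the pole in the same fiber of `(x² + p² + qr)/(x - p)` are equal or exchanged by
the involution `x ↦ (p - q)(p - r)/(x - p) + p`. -/
theorem eq_iff_eq_or_mul_eq_of_add_eq_zero (hsum : p + q + r = 0) {x₁ x₂ : K}
    (h₁ : x₁ ≠ p) (h₂ : x₂ ≠ p) :
    (x₁ ^ 2 + (p ^ 2 + q * r)) / (x₁ - p) = (x₂ ^ 2 + (p ^ 2 + q * r)) / (x₂ - p) ↔
      x₂ = x₁ ∨ (x₁ - p) * (x₂ - p) = (p - q) * (p - r) := by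
  obtain rfl : r = -p - q := by linear_combination hsum
  rw [div_eq_div_iff (sub_ne_zero.2 h₁) (sub_ne_zero.2 h₂), ← sub_eq_zero (a := x₂),
    ← sub_eq_zero (b := (p - q) * (p - (-p - q))), ← mul_eq_zero]
  constructor <;> intro h <;> linear_combination -h

theorem mul_eq_iff_eq_div_add {a x₁ x₂ : K} (h₁ : x₁ ≠ p) :
    (x₁ - p) * (x₂ - p) = a ↔ x₂ = a / (x₁ - p) + p := by
  rw [← sub_eq_iff_eq_add, eq_div_iff (sub_ne_zero.2 h₁), mul_comm]

theorem translate_mem_curve {x y : K} (hx : x ≠ p)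
    (h : y ^ 2 = 4 * (x - p) * (x - q) * (x - r)) :
    ((p - q) * (p - r) * y / (x - p) ^ 2) ^ 2 =
      4 * ((p - q) * (p - r) / (x - p) + p - p) * ((p - q) * (p - r) / (x - p) + p - q) *
        ((p - q) * (p - r) / (x - p) + p - r) := by
  have ht := sub_ne_zero.2 hx
  rw [div_pow, mul_pow, h]
  field_simp
  ring

/-- The fiber of `(x² + p² + qr)/(x - p)` on `y² = 4(x - p)(x - q)(x - r)` through a point is its
orbit under `y ↦ -y` and the translation by the two-torsion point `(p, 0)`. -/
theorem mem_fiber_iff_mem_orbit (hsum : p + q + r = 0) (hpq : p ≠ q) (hpr : p ≠ r)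
    {x₁ y₁ : K} (h₁ : y₁ ^ 2 = 4 * (x₁ - p) * (x₁ - q) * (x₁ - r)) (hx₁ : x₁ ≠ p) (x₂ y₂ : K) :
    (y₂ ^ 2 = 4 * (x₂ - p) * (x₂ - q) * (x₂ - r) ∧ x₂ ≠ p ∧
      (x₂ ^ 2 + (p ^ 2 + q * r)) / (x₂ - p) = (x₁ ^ 2 + (p ^ 2 + q * r)) / (x₁ - p)) ↔
    ((x₂ = x₁ ∧ y₂ = y₁) ∨ (x₂ = x₁ ∧ y₂ = -y₁) ∨
      (x₂ = (p - q) * (p - r) / (x₁ - p) + p ∧ y₂ = (p - q) * (p - r) * y₁ / (x₁ - p) ^ 2) ∨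
      (x₂ = (p - q) * (p - r) / (x₁ - p) + p ∧
        y₂ = -((p - q) * (p - r) * y₁ / (x₁ - p) ^ 2))) := by
  have hσ := translate_mem_curve hx₁ h₁
  have hne : (p - q) * (p - r) / (x₁ - p) + p ≠ p := by
    simp [sub_ne_zero.2 hpq, sub_ne_zero.2 hpr, sub_ne_zero.2 hx₁]
  have hfib : ∀ hx₂ : x₂ ≠ p, _ := fun hx₂ =>
    (eq_comm.trans (eq_iff_eq_or_mul_eq_of_add_eq_zero hsum hx₁ hx₂)).trans
      (or_congr_right (mul_eq_iff_eq_div_add hx₁))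
  rw [← or_assoc, ← and_or_left, ← and_or_left, ← sq_eq_sq_iff_eq_or_eq_neg,
    ← sq_eq_sq_iff_eq_or_eq_neg]
  constructor
  · rintro ⟨h₂, hx₂, hu⟩
    rcases (hfib hx₂).1 hu with rfl | rfl
    · exact .inl ⟨rfl, h₂.trans h₁.symm⟩
    · exact .inr ⟨rfl, h₂.trans hσ.symm⟩
  · rintro (⟨rfl, hy⟩ | ⟨rfl, hy⟩)
    · exact ⟨hy.trans h₁, hx₁, rfl⟩
    · exact ⟨hy.trans hσ, hne, (hfib hne).2 (.inr rfl)⟩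

end TwoTorsionTranslation

/-- Fix `i`.  If `x₁, x₂ ≠ eᵢ` satisfy
`(x₁²+cᵢ)/(x₁-eᵢ) = (x₂²+cᵢ)/(x₂-eᵢ)`, then either `x₂ = x₁` or
`(x₁-eᵢ)(x₂-eᵢ) = aᵢ`.  Consequently, for `(x₁,y₁)` on the curve
`y² = 4(x-e₁)(x-e₂)(x-e₃)` with `x₁ ≠ eᵢ`, the fiber of
`uᵢ(x) = (x²+cᵢ)/(x-eᵢ)` through `(x₁,y₁)` is exactly the
`⟨σ₀,σᵢ⟩`-orbit `{(x₁,y₁), (x₁,-y₁), (x₁',y₁'), (x₁',-y₁')}`, where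
`x₁' = aᵢ/(x₁-eᵢ)+eᵢ` and `y₁' = aᵢy₁/(x₁-eᵢ)²`. -/
theorem stmt_9 (e : Fin 3 → ℂ) (hinj : Function.Injective e)
    (hsum : e 0 + e 1 + e 2 = 0) (a c : Fin 3 → ℂ)
    (ha : ∀ i : Fin 3, a i = (e i - e (i + 1)) * (e i - e (i + 2)))
    (hc : ∀ i : Fin 3, c i = (e i) ^ 2 + e (i + 1) * e (i + 2))
    (i : Fin 3) :
    (∀ x₁ x₂ : ℂ, x₁ ≠ e i → x₂ ≠ e i →
      (x₁ ^ 2 + c i) / (x₁ - e i) = (x₂ ^ 2 + c i) / (x₂ - e i) →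
      x₂ = x₁ ∨ (x₁ - e i) * (x₂ - e i) = a i)
    ∧ (∀ x₁ y₁ : ℂ, y₁ ^ 2 = 4 * (x₁ - e 0) * (x₁ - e 1) * (x₁ - e 2) →
        x₁ ≠ e i →
        ∀ x₂ y₂ : ℂ,
          (y₂ ^ 2 = 4 * (x₂ - e 0) * (x₂ - e 1) * (x₂ - e 2) ∧ x₂ ≠ e i ∧
            (x₂ ^ 2 + c i) / (x₂ - e i) = (x₁ ^ 2 + c i) / (x₁ - e i))
          ↔ ((x₂ = x₁ ∧ y₂ = y₁) ∨ (x₂ = x₁ ∧ y₂ = -y₁) ∨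
             (x₂ = a i / (x₁ - e i) + e i ∧ y₂ = a i * y₁ / (x₁ - e i) ^ 2) ∨
             (x₂ = a i / (x₁ - e i) + e i ∧
               y₂ = -(a i * y₁ / (x₁ - e i) ^ 2)))) := by
  have hcurve (x : ℂ) : 4 * (x - e 0) * (x - e 1) * (x - e 2) =
      4 * (x - e i) * (x - e (i + 1)) * (x - e (i + 2)) := by
    fin_cases i <;> simp <;> ring
  have hs : e i + e (i + 1) + e (i + 2) = 0 := by
    rw [← hsum]
    fin_cases i <;> simp <;> ring
  have h₁ : e i ≠ e (i + 1) := hinj.ne (by fin_cases i <;> decide)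
  have h₂ : e i ≠ e (i + 2) := hinj.ne (by fin_cases i <;> decide)
  simp only [hcurve, ha, hc]
  exact ⟨fun x₁ x₂ hx₁ hx₂ => (eq_iff_eq_or_mul_eq_of_add_eq_zero hs hx₁ hx₂).1,
    fun x₁ y₁ hy hx => mem_fiber_iff_mem_orbit hs h₁ h₂ hy hx⟩
end

section
/- Fix k ∈ {1,2,3} and let i, j be the other two indices. The rational function v_k(x,y) = y/(c_k + 2e_k·x − x²) is invariant under σᵢ and σⱼ: if (x,y) ∈ ℂ² satisfies y² = 4(x−e₁)(x−e₂)(x−e₃), x ≠ e_l, and c_k + 2e_k·x − x² ≠ 0, then for l ∈ {i,j}, writing (x',y') = σ_l(x,y), one has c_k + 2e_k·x' − x'² ≠ 0 and y'/(c_k + 2e_k·x' − x'²) = y/(c_k + 2e_k·x − x²). Hence v_k is invariant under the Klein four-group ⟨σᵢ, σⱼ⟩, so that ℂ(v_k) is contained in the fixed field Kᵢⱼ of ⟨σᵢ, σⱼ⟩ acting on ℂ(x,y). -/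
/-- The involution `x ↦ a / (x - q) + q` with `a = (q - p) * (q - r)` rescales the quadratic
`p ^ 2 + q * r + 2 * p * x - x ^ 2` by the factor `a / (x - q) ^ 2` when `p + q + r = 0`. -/
lemma quadratic_comp_involution {K : Type*} [Field K] {p q r x : K} (h : p + q + r = 0)
    (hx : x ≠ q) :
    p ^ 2 + q * r + 2 * p * ((q - p) * (q - r) / (x - q) + q)
        - ((q - p) * (q - r) / (x - q) + q) ^ 2
      = (q - p) * (q - r) / (x - q) ^ 2 * (p ^ 2 + q * r + 2 * p * x - x ^ 2) := by
  have ht : x - q ≠ 0 := sub_ne_zero.mpr hx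
  obtain rfl : r = -p - q := by linear_combination h
  field_simp
  ring

/-- Fix `k` with other indices `i, j` (any `l ≠ k`).  The
function `v_k(x,y) = y/(c_k+2e_kx-x²)` is invariant under `σ_l` for `l ≠ k`:
if `(x,y)` lies on `y² = 4(x-e₁)(x-e₂)(x-e₃)`, `x ≠ e_l` and
`c_k+2e_kx-x² ≠ 0`, then writing `(x',y') = σ_l(x,y)` one has
`c_k+2e_kx'-x'² ≠ 0` and `y'/(c_k+2e_kx'-x'²) = y/(c_k+2e_kx-x²)`.
Hence `v_k` is invariant under the Klein four-group `⟨σᵢ,σⱼ⟩`. -/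
theorem stmt_10 (e : Fin 3 → ℂ) (hinj : Function.Injective e)
    (hsum : e 0 + e 1 + e 2 = 0) (a c : Fin 3 → ℂ)
    (ha : ∀ i : Fin 3, a i = (e i - e (i + 1)) * (e i - e (i + 2)))
    (hc : ∀ i : Fin 3, c i = (e i) ^ 2 + e (i + 1) * e (i + 2))
    (k l : Fin 3) (hl : l ≠ k) (x y : ℂ)
    (hcurve : y ^ 2 = 4 * (x - e 0) * (x - e 1) * (x - e 2))
    (hx : x ≠ e l) (hD : c k + 2 * e k * x - x ^ 2 ≠ 0) (x' y' : ℂ)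
    (hx' : x' = a l / (x - e l) + e l)
    (hy' : y' = a l * y / (x - e l) ^ 2) :
    c k + 2 * e k * x' - x' ^ 2 ≠ 0 ∧
      y' / (c k + 2 * e k * x' - x' ^ 2) = y / (c k + 2 * e k * x - x ^ 2) := by
  obtain ⟨m, hlm, hsum', hal, hck⟩ : ∃ m, l ≠ m ∧ e k + e l + e m = 0 ∧
      a l = (e l - e k) * (e l - e m) ∧ c k = e k ^ 2 + e l * e m := by
    have hcases : ∀ k l : Fin 3, l ≠ k →
        l = k + 1 ∧ k + 1 ≠ k + 2 ∧ k + 1 + 1 = k + 2 ∧ k + 1 + 2 = k ∨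
        l = k + 2 ∧ k + 2 ≠ k + 1 ∧ k + 2 + 1 = k ∧ k + 2 + 2 = k + 1 := by decide
    have hsum_shift : e k + e (k + 1) + e (k + 2) = 0 := by
      have hperm : ∀ k : Fin 3, k = 0 ∧ k + 1 = 1 ∧ k + 2 = 2 ∨
          k = 1 ∧ k + 1 = 2 ∧ k + 2 = 0 ∨ k = 2 ∧ k + 1 = 0 ∧ k + 2 = 1 := by decide
      rcases hperm k with ⟨h0, h1, h2⟩ | ⟨h0, h1, h2⟩ | ⟨h0, h1, h2⟩ <;>
        rw [h1, h2, h0] <;> linear_combination hsum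
    obtain ⟨rfl, hne, h1, h2⟩ | ⟨rfl, hne, h1, h2⟩ := hcases k l hl
    · exact ⟨k + 2, hne, hsum_shift, by rw [ha, h1, h2, mul_comm], hc k⟩
    · exact ⟨k + 1, hne, by linear_combination hsum_shift, by rw [ha, h1, h2],
        by rw [hc, mul_comm (e (k + 1))]⟩
  have hal0 : a l ≠ 0 := by
    rw [hal]
    exact mul_ne_zero (sub_ne_zero.mpr (hinj.ne hl)) (sub_ne_zero.mpr (hinj.ne hlm))
  have hfac : a l / (x - e l) ^ 2 ≠ 0 :=
    div_ne_zero hal0 (pow_ne_zero 2 (sub_ne_zero.mpr hx))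
  have hD' : c k + 2 * e k * x' - x' ^ 2
      = a l / (x - e l) ^ 2 * (c k + 2 * e k * x - x ^ 2) := by
    rw [hx', hck, hal]
    exact quadratic_comp_involution hsum' hx
  rw [hD', hy', mul_div_right_comm]
  exact ⟨mul_ne_zero hfac hD, mul_div_mul_left _ _ hfac⟩
end

section
/- Fix k ∈ {1,2,3} with other indices i, j, and write D_k(x) = c_k + 2e_k·x − x². Let (x₁,y₁) satisfy y₁² = 4(x₁−e₁)(x₁−e₂)(x₁−e₃) with x₁ ∉ {e₁,e₂,e₃}, y₁ ≠ 0, and D_k(x₁) ≠ 0. Then the set of points (x₂,y₂) with y₂² = 4(x₂−e₁)(x₂−e₂)(x₂−e₃), D_k(x₂) ≠ 0, and y₂/D_k(x₂) = y₁/D_k(x₁) is exactly the four-element orbit {(x₁,y₁), σᵢ(x₁,y₁), σⱼ(x₁,y₁), (a_k/(x₁−e_k)+e_k, −a_k·y₁/(x₁−e_k)²)} of the Klein four-group ⟨σᵢ,σⱼ⟩, whose fourth element is σᵢσⱼ(x₁,y₁). -/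
open Complex

section Fiber

variable {p q r x₁ y₁ : ℂ}

private lemma denom_eq (hs : p + q + r = 0) (x : ℂ) :
    r ^ 2 + p * q + 2 * r * x - x ^ 2 = (r - p) * (r - q) - (x - r) ^ 2 := by
  linear_combination r * hs

/-- Under translation by the 2-torsion point of a root `p` other than `r`, the denominator of `v`
is scaled by the same factor as `y`, so `v` is invariant. -/
private lemma denom_translate (hs : p + q + r = 0) (hx : x₁ ≠ p) {x₂ : ℂ}
    (h : x₂ = (p - q) * (p - r) / (x₁ - p) + p) :
    r ^ 2 + p * q + 2 * r * x₂ - x₂ ^ 2 =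
      (p - q) * (p - r) / (x₁ - p) ^ 2 * (r ^ 2 + p * q + 2 * r * x₁ - x₁ ^ 2) := by
  have hx' := sub_ne_zero.2 hx
  rw [denom_eq hs, denom_eq hs, h]
  field_simp
  ring

private lemma denom_translate_self (hs : p + q + r = 0) (hx : x₁ ≠ r) {x₂ : ℂ}
    (h : x₂ = (r - p) * (r - q) / (x₁ - r) + r) :
    r ^ 2 + p * q + 2 * r * x₂ - x₂ ^ 2 =
      -((r - p) * (r - q) / (x₁ - r) ^ 2) * (r ^ 2 + p * q + 2 * r * x₁ - x₁ ^ 2) := by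
  have hx' := sub_ne_zero.2 hx
  rw [denom_eq hs, denom_eq hs, h]
  field_simp
  ring

private lemma cubic_translate (hx : x₁ ≠ p) {x₂ : ℂ}
    (h : x₂ = (p - q) * (p - r) / (x₁ - p) + p) :
    (x₂ - p) * (x₂ - q) * (x₂ - r) =
      ((p - q) * (p - r) / (x₁ - p) ^ 2) ^ 2 * ((x₁ - p) * (x₁ - q) * (x₁ - r)) := by
  have hx' := sub_ne_zero.2 hx
  rw [h]
  field_simp
  ring

private lemma eq_translate_of_mul_eq {a e x₂ : ℂ} (hx : x₁ ≠ e)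
    (h : (x₂ - e) * (x₁ - e) - a = 0) : x₂ = a / (x₁ - e) + e := by
  have hx' := sub_ne_zero.2 hx
  field_simp
  linear_combination h

/-- If both the cubic and the denominator scale compatibly with `y ↦ s * y`, then `s * y₁` is the
only ordinate giving a point of the fiber. -/
private lemma fiber_iff_of_scale {f₁ f₂ d₁ d₂ s y₂ : ℂ} (hcurve : y₁ ^ 2 = 4 * f₁) (hd : d₁ ≠ 0)
    (hs : s ≠ 0) (hf₂ : f₂ = s ^ 2 * f₁) (hd₂ : d₂ = s * d₁) :
    (y₂ ^ 2 = 4 * f₂ ∧ d₂ ≠ 0 ∧ y₂ / d₂ = y₁ / d₁) ↔ y₂ = s * y₁ := by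
  subst hf₂ hd₂
  constructor
  · rintro ⟨-, -, h⟩
    rw [div_eq_div_iff (mul_ne_zero hs hd) hd] at h
    exact mul_right_cancel₀ hd (by linear_combination h)
  · rintro rfl
    exact ⟨by linear_combination s ^ 2 * hcurve, mul_ne_zero hs hd, mul_div_mul_left _ _ hs⟩

private lemma fiber_iff_orbit (hs : p + q + r = 0) (hpq : p ≠ q) (hpr : p ≠ r) (hqr : q ≠ r)
    (hcurve : y₁ ^ 2 = 4 * ((x₁ - p) * (x₁ - q) * (x₁ - r)))
    (hp : x₁ ≠ p) (hq : x₁ ≠ q) (hr : x₁ ≠ r)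
    (hD : r ^ 2 + p * q + 2 * r * x₁ - x₁ ^ 2 ≠ 0) (x₂ y₂ : ℂ) :
    (y₂ ^ 2 = 4 * ((x₂ - p) * (x₂ - q) * (x₂ - r)) ∧
        r ^ 2 + p * q + 2 * r * x₂ - x₂ ^ 2 ≠ 0 ∧
        y₂ / (r ^ 2 + p * q + 2 * r * x₂ - x₂ ^ 2) =
          y₁ / (r ^ 2 + p * q + 2 * r * x₁ - x₁ ^ 2)) ↔
      ((x₂ = x₁ ∧ y₂ = y₁) ∨
       (x₂ = (p - q) * (p - r) / (x₁ - p) + p ∧ y₂ = (p - q) * (p - r) * y₁ / (x₁ - p) ^ 2) ∨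
       (x₂ = (q - r) * (q - p) / (x₁ - q) + q ∧ y₂ = (q - r) * (q - p) * y₁ / (x₁ - q) ^ 2) ∨
       (x₂ = (r - p) * (r - q) / (x₁ - r) + r ∧
          y₂ = -((r - p) * (r - q) * y₁ / (x₁ - r) ^ 2))) := by
  have hDp := fun h => denom_translate hs hp (x₂ := x₂) h
  have hDq (h : x₂ = (q - r) * (q - p) / (x₁ - q) + q) :
      r ^ 2 + p * q + 2 * r * x₂ - x₂ ^ 2 =
        (q - r) * (q - p) / (x₁ - q) ^ 2 * (r ^ 2 + p * q + 2 * r * x₁ - x₁ ^ 2) := by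
    rw [mul_comm (q - r)] at h ⊢
    rw [mul_comm p q]
    exact denom_translate (by linear_combination hs) hq h
  have hDr := fun h => denom_translate_self hs hr (x₂ := x₂) h
  have hp₂ (hx : x₂ = (p - q) * (p - r) / (x₁ - p) + p) :=
    fiber_iff_of_scale (y₂ := y₂) hcurve hD (div_ne_zero (mul_ne_zero (sub_ne_zero.2 hpq)
      (sub_ne_zero.2 hpr)) (pow_ne_zero 2 (sub_ne_zero.2 hp))) (cubic_translate hp hx) (hDp hx)
  have hq₂ (hx : x₂ = (q - r) * (q - p) / (x₁ - q) + q) :=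
    fiber_iff_of_scale (y₂ := y₂) hcurve hD (div_ne_zero (mul_ne_zero (sub_ne_zero.2 hqr)
      (sub_ne_zero.2 hpq.symm)) (pow_ne_zero 2 (sub_ne_zero.2 hq)))
      (f₂ := (x₂ - p) * (x₂ - q) * (x₂ - r))
      (by linear_combination cubic_translate hq hx) (hDq hx)
  have hr₂ (hx : x₂ = (r - p) * (r - q) / (x₁ - r) + r) :=
    fiber_iff_of_scale (y₂ := y₂) hcurve hD (neg_ne_zero.2 (div_ne_zero (mul_ne_zero
      (sub_ne_zero.2 hpr.symm) (sub_ne_zero.2 hqr.symm)) (pow_ne_zero 2 (sub_ne_zero.2 hr))))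
      (f₂ := (x₂ - p) * (x₂ - q) * (x₂ - r))
      (by linear_combination cubic_translate hr hx) (hDr hx)
  simp only [neg_mul, div_mul_eq_mul_div] at hp₂ hq₂ hr₂
  constructor
  · intro h₂
    have hfactor : (x₂ - x₁) * (((x₂ - p) * (x₁ - p) - (p - q) * (p - r)) *
        (((x₂ - q) * (x₁ - q) - (q - r) * (q - p)) *
          ((x₂ - r) * (x₁ - r) - (r - p) * (r - q)))) = 0 := by
      have hsq := congrArg (· ^ 2) ((div_eq_div_iff h₂.2.1 hD).1 h₂.2.2)
      simp only [mul_pow] at hsq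
      rw [h₂.1, hcurve, denom_eq hs, denom_eq hs] at hsq
      linear_combination (-1 / 4) * hsq
    rcases mul_eq_zero.1 hfactor with h | h
    · obtain rfl : x₂ = x₁ := sub_eq_zero.1 h
      exact Or.inl ⟨rfl, (div_left_inj' hD).1 h₂.2.2⟩
    rcases mul_eq_zero.1 h with h | h
    · have hx := eq_translate_of_mul_eq hp h
      exact Or.inr (Or.inl ⟨hx, (hp₂ hx).1 h₂⟩)
    rcases mul_eq_zero.1 h with h | h
    · have hx := eq_translate_of_mul_eq hq h
      exact Or.inr (Or.inr (Or.inl ⟨hx, (hq₂ hx).1 h₂⟩))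
    · have hx := eq_translate_of_mul_eq hr h
      exact Or.inr (Or.inr (Or.inr ⟨hx, (hr₂ hx).1 h₂⟩))
  · rintro (⟨rfl, rfl⟩ | ⟨hx, hy⟩ | ⟨hx, hy⟩ | ⟨hx, hy⟩)
    · exact ⟨hcurve, hD, rfl⟩
    · exact (hp₂ hx).2 hy
    · exact (hq₂ hx).2 hy
    · exact (hr₂ hx).2 hy

private lemma translate_comp (hpq : p ≠ q) (hq : x₁ ≠ q) (hr : x₁ ≠ r) :
    (q - r) * (q - p) / (x₁ - q) + q ≠ p ∧
      (p - q) * (p - r) / (((q - r) * (q - p) / (x₁ - q) + q) - p) + p =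
        (r - p) * (r - q) / (x₁ - r) + r ∧
      (p - q) * (p - r) * ((q - r) * (q - p) * y₁ / (x₁ - q) ^ 2) /
          (((q - r) * (q - p) / (x₁ - q) + q) - p) ^ 2 =
        -((r - p) * (r - q) * y₁ / (x₁ - r) ^ 2) := by
  have hq' := sub_ne_zero.2 hq
  have hr' := sub_ne_zero.2 hr
  have hqp' := sub_ne_zero.2 hpq.symm
  have key : (q - r) * (q - p) / (x₁ - q) + q - p = (q - p) * (x₁ - r) / (x₁ - q) := by
    field_simp
    ring
  refine ⟨?_, ?_, ?_⟩
  · rw [← sub_ne_zero, key]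
    positivity
  · rw [key]
    field_simp
    ring
  · rw [key]
    field_simp
    ring

end Fiber


/-- Fix `k` with other indices `i = k+1`, `j = k+2`
(cyclically) and write `D_k(x) = c_k+2e_kx-x²`.  Let `(x₁,y₁)` lie on
`y² = 4(x-e₁)(x-e₂)(x-e₃)` with `x₁ ∉ {e₁,e₂,e₃}`, `y₁ ≠ 0`, `D_k(x₁) ≠ 0`.
Then the fiber of `v_k(x,y) = y/D_k(x)` through `(x₁,y₁)` is exactly the
four-element `⟨σᵢ,σⱼ⟩`-orbit
`{(x₁,y₁), σᵢ(x₁,y₁), σⱼ(x₁,y₁), (a_k/(x₁-e_k)+e_k, -a_ky₁/(x₁-e_k)²)}`,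
whose fourth element is `σᵢσⱼ(x₁,y₁)`. -/
theorem stmt_11 (e : Fin 3 → ℂ) (hinj : Function.Injective e)
    (hsum : e 0 + e 1 + e 2 = 0) (a c : Fin 3 → ℂ)
    (ha : ∀ i : Fin 3, a i = (e i - e (i + 1)) * (e i - e (i + 2)))
    (hc : ∀ i : Fin 3, c i = (e i) ^ 2 + e (i + 1) * e (i + 2))
    (k : Fin 3) (x₁ y₁ : ℂ)
    (hcurve : y₁ ^ 2 = 4 * (x₁ - e 0) * (x₁ - e 1) * (x₁ - e 2))
    (hx₁ : ∀ i : Fin 3, x₁ ≠ e i) (hy₁ : y₁ ≠ 0)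
    (hD₁ : c k + 2 * e k * x₁ - x₁ ^ 2 ≠ 0) :
    -- the fiber of v_k through (x₁,y₁) is the ⟨σᵢ,σⱼ⟩-orbit of (x₁,y₁)
    (∀ x₂ y₂ : ℂ,
      (y₂ ^ 2 = 4 * (x₂ - e 0) * (x₂ - e 1) * (x₂ - e 2) ∧
        c k + 2 * e k * x₂ - x₂ ^ 2 ≠ 0 ∧
        y₂ / (c k + 2 * e k * x₂ - x₂ ^ 2) =
          y₁ / (c k + 2 * e k * x₁ - x₁ ^ 2))
      ↔ ((x₂ = x₁ ∧ y₂ = y₁) ∨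
         (x₂ = a (k + 1) / (x₁ - e (k + 1)) + e (k + 1) ∧
           y₂ = a (k + 1) * y₁ / (x₁ - e (k + 1)) ^ 2) ∨
         (x₂ = a (k + 2) / (x₁ - e (k + 2)) + e (k + 2) ∧
           y₂ = a (k + 2) * y₁ / (x₁ - e (k + 2)) ^ 2) ∨
         (x₂ = a k / (x₁ - e k) + e k ∧
           y₂ = -(a k * y₁ / (x₁ - e k) ^ 2))))
    -- and the fourth element above is σᵢ(σⱼ(x₁,y₁)):
    ∧ (a (k + 2) / (x₁ - e (k + 2)) + e (k + 2) ≠ e (k + 1) ∧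
       a (k + 1) / ((a (k + 2) / (x₁ - e (k + 2)) + e (k + 2)) - e (k + 1))
           + e (k + 1)
         = a k / (x₁ - e k) + e k ∧
       a (k + 1) * (a (k + 2) * y₁ / (x₁ - e (k + 2)) ^ 2) /
           ((a (k + 2) / (x₁ - e (k + 2)) + e (k + 2)) - e (k + 1)) ^ 2
         = -(a k * y₁ / (x₁ - e k) ^ 2)) := by
  have hcubic (x : ℂ) : 4 * (x - e 0) * (x - e 1) * (x - e 2) =
      4 * ((x - e (k + 1)) * (x - e (k + 2)) * (x - e k)) := by
    fin_cases k <;> simp <;> ring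
  have hs : e (k + 1) + e (k + 2) + e k = 0 := by
    rw [← hsum]
    fin_cases k <;> simp <;> ring
  have h₁₂ : e (k + 1) ≠ e (k + 2) := hinj.ne (by simp)
  have h₁₀ : e (k + 1) ≠ e k := hinj.ne (by simp)
  have h₂₀ : e (k + 2) ≠ e k := hinj.ne (by simp)
  have ha₁ : a (k + 1) = (e (k + 1) - e (k + 2)) * (e (k + 1) - e k) := by
    rw [ha]
    fin_cases k <;> rfl
  have ha₂ : a (k + 2) = (e (k + 2) - e k) * (e (k + 2) - e (k + 1)) := by
    rw [ha]
    fin_cases k <;> rfl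
  rw [hc] at hD₁
  simp only [hc k, ha k, ha₁, ha₂, hcubic] at hcurve ⊢
  exact ⟨fiber_iff_orbit hs h₁₂ h₁₀ h₂₀ hcurve (hx₁ _) (hx₁ _) (hx₁ _) hD₁,
    translate_comp h₁₂ (hx₁ _) (hx₁ _)⟩
end

section
/- Each σ_{mn} with (m,n) ∈ {(0,0),(2,2),(2,0),(0,2),(3,1),(1,3),(1,1),(3,3)} is a bijection of T of order 4, and writing G_{mn} = ⟨σ_{mn}⟩ for the cyclic subgroup it generates in the permutation group of T, one has: G_{00} ∩ G_{22} = ⟨σ₀⟩, G_{20} ∩ G_{02} = ⟨σ₃⟩, G_{11} ∩ G_{33} = ⟨σ₂⟩, and G_{31} ∩ G_{13} = ⟨σ₁⟩. In particular, the square of each σ_{mn} is the involution σ₀, σ₃, σ₂, σ₁ respectively, and the eight subgroups G_{mn} are pairwise distinct. -/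
open Complex

/-- The lattice `ℤ[i] = {m + ni : m, n ∈ ℤ}` of Gaussian integers as an
additive subgroup of `ℂ`. -/
noncomputable def gaussInt : AddSubgroup ℂ where
  carrier := {z | ∃ m n : ℤ, z = (m : ℂ) + (n : ℂ) * I}
  zero_mem' := ⟨0, 0, by simp⟩
  add_mem' := by
    rintro x y ⟨m, n, rfl⟩ ⟨m', n', rfl⟩
    exact ⟨m + m', n + n', by push_cast; ring⟩
  neg_mem' := by
    rintro x ⟨m, n, rfl⟩
    exact ⟨-m, -n, by push_cast; ring⟩

noncomputable def mulIQuot : (ℂ ⧸ gaussInt) →+ (ℂ ⧸ gaussInt) :=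
  QuotientAddGroup.map _ _ (AddMonoidHom.mulLeft I) (by
    rintro z ⟨m, n, rfl⟩
    refine ⟨-n, m, ?_⟩
    simp only [AddMonoidHom.coe_mulLeft]
    push_cast
    linear_combination (n : ℂ) * Complex.I_mul_I)

noncomputable def mulNegIQuot : (ℂ ⧸ gaussInt) →+ (ℂ ⧸ gaussInt) :=
  QuotientAddGroup.map _ _ (AddMonoidHom.mulLeft (-I)) (by
    rintro z ⟨m, n, rfl⟩
    refine ⟨n, -m, ?_⟩
    simp only [AddMonoidHom.coe_mulLeft]
    push_cast
    linear_combination (-n : ℂ) * Complex.I_mul_I)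

noncomputable def mulIEquiv : (ℂ ⧸ gaussInt) ≃+ (ℂ ⧸ gaussInt) :=
  AddMonoidHom.toAddEquiv mulIQuot mulNegIQuot
    (by
      refine DFunLike.ext _ _ fun x => ?_
      refine QuotientAddGroup.induction_on x fun z => ?_
      show mulNegIQuot (mulIQuot (QuotientAddGroup.mk z)) = QuotientAddGroup.mk z
      rw [mulIQuot, mulNegIQuot, QuotientAddGroup.map_mk, QuotientAddGroup.map_mk]
      simp only [AddMonoidHom.coe_mulLeft]
      congr 1
      linear_combination (-z : ℂ) * Complex.I_mul_I)
    (by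
      refine DFunLike.ext _ _ fun x => ?_
      refine QuotientAddGroup.induction_on x fun z => ?_
      show mulIQuot (mulNegIQuot (QuotientAddGroup.mk z)) = QuotientAddGroup.mk z
      rw [mulIQuot, mulNegIQuot, QuotientAddGroup.map_mk, QuotientAddGroup.map_mk]
      simp only [AddMonoidHom.coe_mulLeft]
      congr 1
      linear_combination (-z : ℂ) * Complex.I_mul_I)

/-- The eight pairs `(m,n)` appearing in the paper. -/
def eightPairs : Set (ℤ × ℤ) :=
  {(0, 0), (2, 2), (2, 0), (0, 2), (3, 1), (1, 3), (1, 1), (3, 3)}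

theorem mem_gaussInt_iff {z : ℂ} : z ∈ gaussInt ↔ ∃ m n : ℤ, z = (m : ℂ) + (n : ℂ) * I :=
  Iff.rfl

theorem mulIEquiv_mk (z : ℂ) :
    mulIEquiv ((z : ℂ) : ℂ ⧸ gaussInt) = ((I * z : ℂ) : ℂ ⧸ gaussInt) :=
  rfl

theorem mulIEquiv_mulIEquiv (t : ℂ ⧸ gaussInt) : mulIEquiv (mulIEquiv t) = -t := by
  induction t using QuotientAddGroup.induction_on with
  | H z =>
    rw [mulIEquiv_mk, mulIEquiv_mk, ← QuotientAddGroup.mk_neg]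
    congr 1
    linear_combination z * I_mul_I

/-- The affine permutation `t ↦ i·t + c` of `ℂ/ℤ[i]`. -/
noncomputable def mulIAddPerm (c : ℂ ⧸ gaussInt) : Equiv.Perm (ℂ ⧸ gaussInt) :=
  mulIEquiv.toEquiv.trans (Equiv.addRight c)

theorem mulIAddPerm_apply (c t : ℂ ⧸ gaussInt) : mulIAddPerm c t = mulIEquiv t + c :=
  rfl

theorem mulIAddPerm_injective : Function.Injective mulIAddPerm := fun c d h => by
  simpa [mulIAddPerm_apply] using DFunLike.congr_fun h 0

theorem mulIAddPerm_mul_apply (c d t : ℂ ⧸ gaussInt) :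
    (mulIAddPerm c * mulIAddPerm d) t = -t + (mulIEquiv d + c) := by
  rw [Equiv.Perm.mul_apply, mulIAddPerm_apply, mulIAddPerm_apply, map_add, mulIEquiv_mulIEquiv,
    add_assoc]

theorem mulIAddPerm_sq (c : ℂ ⧸ gaussInt) :
    mulIAddPerm c ^ 2 =
      (Equiv.neg (ℂ ⧸ gaussInt)).trans (Equiv.addRight (mulIEquiv c + c)) := by
  ext t
  rw [sq, mulIAddPerm_mul_apply]
  rfl

theorem mulIAddPerm_pow_four (c : ℂ ⧸ gaussInt) : mulIAddPerm c ^ 4 = 1 := by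
  ext t
  rw [show 4 = 2 + 2 from rfl, pow_add, sq, Equiv.Perm.mul_apply, mulIAddPerm_mul_apply,
    mulIAddPerm_mul_apply, Equiv.Perm.one_apply]
  abel

theorem mulIAddPerm_mul_ne_one (c d : ℂ ⧸ gaussInt) : mulIAddPerm c * mulIAddPerm d ≠ 1 := by
  intro h
  have key (t : ℂ ⧸ gaussInt) : -t + (mulIEquiv d + c) = t := by
    rw [← mulIAddPerm_mul_apply, h, Equiv.Perm.one_apply]
  have h0 : mulIEquiv d + c = 0 := by simpa using key 0
  have h1 := key ((1 / 4 : ℂ) : ℂ ⧸ gaussInt)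
  rw [h0, add_zero, ← QuotientAddGroup.mk_neg, QuotientAddGroup.eq, mem_gaussInt_iff] at h1
  obtain ⟨m, n, hmn⟩ := h1
  have hre := congrArg Complex.re hmn
  norm_num at hre
  have : (1 : ℝ) = ((2 * m : ℤ) : ℝ) := by push_cast; linarith
  have : (1 : ℤ) = 2 * m := by exact_mod_cast this
  omega

theorem orderOf_mulIAddPerm (c : ℂ ⧸ gaussInt) : orderOf (mulIAddPerm c) = 4 :=
  orderOf_eq_prime_pow (p := 2) (n := 1)
    (by simpa [sq] using mulIAddPerm_mul_ne_one c c) (mulIAddPerm_pow_four c)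

theorem eq_of_mulIAddPerm_mem_zpowers {c d : ℂ ⧸ gaussInt}
    (h : mulIAddPerm c ∈ Subgroup.zpowers (mulIAddPerm d)) : c = d := by
  classical
  have hfin : IsOfFinOrder (mulIAddPerm d) :=
    isOfFinOrder_iff_pow_eq_one.2 ⟨4, by norm_num, mulIAddPerm_pow_four d⟩
  rw [hfin.mem_zpowers_iff_mem_range_orderOf, orderOf_mulIAddPerm, Finset.mem_image] at h
  obtain ⟨k, hk, hkc⟩ := h
  rw [Finset.mem_range] at hk
  interval_cases k
  · exact absurd (by rw [← hkc]; simp) (mulIAddPerm_mul_ne_one c c)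
  · exact mulIAddPerm_injective (by rw [← hkc, pow_one])
  · exact absurd (by rw [← hkc, ← pow_add, mulIAddPerm_pow_four]) (mulIAddPerm_mul_ne_one c c)
  · exact absurd (by rw [← hkc, ← pow_succ, mulIAddPerm_pow_four]) (mulIAddPerm_mul_ne_one c d)

theorem Subgroup.zpowers_inf_zpowers_of_sq_eq {G : Type*} [Group G] {a b s : G}
    (ha : a ^ 2 = s) (hb : b ^ 2 = s) (hab : a ∉ Subgroup.zpowers b) :
    Subgroup.zpowers a ⊓ Subgroup.zpowers b = Subgroup.zpowers s := by
  have hsa : s ∈ Subgroup.zpowers a := ha ▸ Subgroup.npow_mem_zpowers a 2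
  have hsb : s ∈ Subgroup.zpowers b := hb ▸ Subgroup.npow_mem_zpowers b 2
  refine le_antisymm ?_ (le_inf (by simpa using hsa) (by simpa using hsb))
  rintro x ⟨⟨k, rfl⟩, hx⟩
  have hpow (j : ℤ) : a ^ (2 * j) = s ^ j := by rw [zpow_mul, ← ha]; norm_cast
  obtain ⟨j, rfl | rfl⟩ := Int.even_or_odd' k
  · exact ⟨j, (hpow j).symm⟩
  · refine absurd ?_ hab
    change a ^ (2 * j + 1) ∈ Subgroup.zpowers b at hx
    rwa [zpow_add_one, hpow,
      (Subgroup.zpowers b).mul_mem_cancel_left ((Subgroup.zpowers b).zpow_mem hsb j)] at hx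

/-- The class of `(m + ni)/4` in `ℂ/ℤ[i]`. -/
noncomputable def quarterClass (p : ℤ × ℤ) : ℂ ⧸ gaussInt :=
  ((((p.1 : ℂ) + (p.2 : ℂ) * I) / 4 : ℂ) : ℂ ⧸ gaussInt)

theorem quarterClass_eq_iff {p q : ℤ × ℤ} :
    quarterClass p = quarterClass q ↔ 4 ∣ q.1 - p.1 ∧ 4 ∣ q.2 - p.2 := by
  rw [quarterClass, quarterClass, QuotientAddGroup.eq, mem_gaussInt_iff]
  constructor
  · rintro ⟨m, n, h⟩
    have h' : ((q.1 - p.1 : ℤ) : ℂ) + ((q.2 - p.2 : ℤ) : ℂ) * I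
        = ((4 * m : ℤ) : ℂ) + ((4 * n : ℤ) : ℂ) * I := by
      push_cast; linear_combination 4 * h
    have hre := congrArg Complex.re h'
    have him := congrArg Complex.im h'
    simp only [add_re, add_im, mul_re, mul_im, intCast_re, intCast_im, I_re, I_im, mul_zero,
      mul_one, sub_zero, add_zero, zero_add] at hre him
    exact ⟨⟨m, by exact_mod_cast hre⟩, ⟨n, by exact_mod_cast him⟩⟩
  · rintro ⟨⟨m, hm⟩, ⟨n, hn⟩⟩
    refine ⟨m, n, ?_⟩
    have hm' : (q.1 : ℂ) - p.1 = 4 * m := by exact_mod_cast hm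
    have hn' : (q.2 : ℂ) - p.2 = 4 * n := by exact_mod_cast hn
    linear_combination hm' / 4 + hn' * I / 4

theorem mulIEquiv_quarterClass_add (m n : ℤ) :
    mulIEquiv (quarterClass (m, n)) + quarterClass (m, n) = quarterClass (m - n, m + n) := by
  simp only [quarterClass]
  rw [mulIEquiv_mk, ← QuotientAddGroup.mk_add]
  congr 1
  push_cast
  linear_combination (n : ℂ) / 4 * I_mul_I

theorem mulIAddPerm_quarterClass_sq {m n : ℤ} {q : ℤ × ℤ} {f : Equiv.Perm (ℂ ⧸ gaussInt)}
    {z : ℂ} (hf : f = (Equiv.neg (ℂ ⧸ gaussInt)).trans (Equiv.addRight ((z : ℂ ⧸ gaussInt))))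
    (hz : z = ((q.1 : ℂ) + (q.2 : ℂ) * I) / 4)
    (hq : 4 ∣ q.1 - (m - n) ∧ 4 ∣ q.2 - (m + n)) :
    mulIAddPerm (quarterClass (m, n)) ^ 2 = f := by
  rw [mulIAddPerm_sq, mulIEquiv_quarterClass_add, quarterClass_eq_iff.2 hq, hf, hz]
  rfl

theorem quarterClass_injOn_eightPairs : Set.InjOn quarterClass eightPairs := by
  rintro ⟨m, n⟩ hp ⟨m', n'⟩ hq h
  obtain ⟨h1, h2⟩ := quarterClass_eq_iff.1 h
  simp only [eightPairs, Set.mem_insert_iff, Set.mem_singleton_iff, Prod.mk.injEq] at hp hq ⊢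
  dsimp only at h1 h2
  omega

/-- On `T = ℂ/ℤ[i]`, let `σ_{mn}(t) = i·t + [(m+ni)/4]`
and `σ₀(t) = -t`, `σ₁(t) = -t + [1/2]`, `σ₂(t) = -t + [i/2]`,
`σ₃(t) = -t + [(1+i)/2]`.  Each `σ_{mn}` with `(m,n)` among the eight pairs
`(0,0),(2,2),(2,0),(0,2),(3,1),(1,3),(1,1),(3,3)` has order 4 in the
permutation group of `T`, and writing `G_{mn} = ⟨σ_{mn}⟩`:
`G_{00} ∩ G_{22} = ⟨σ₀⟩`, `G_{20} ∩ G_{02} = ⟨σ₃⟩`, `G_{11} ∩ G_{33} = ⟨σ₂⟩`,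
`G_{31} ∩ G_{13} = ⟨σ₁⟩`; the square of each `σ_{mn}` is the corresponding
involution `σ₀, σ₃, σ₂, σ₁`; and the eight subgroups `G_{mn}` are pairwise
distinct. -/
theorem stmt_14 (σ : ℤ × ℤ → Equiv.Perm (ℂ ⧸ gaussInt))
    (hσ : ∀ m n : ℤ, σ (m, n) = mulIEquiv.toEquiv.trans
      (Equiv.addRight (((((m : ℂ) + (n : ℂ) * I) / 4 : ℂ) : ℂ ⧸ gaussInt))))
    (τ : Fin 4 → Equiv.Perm (ℂ ⧸ gaussInt))
    (hτ0 : τ 0 = (Equiv.neg (ℂ ⧸ gaussInt)).trans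
      (Equiv.addRight (((0 : ℂ) : ℂ ⧸ gaussInt))))
    (hτ1 : τ 1 = (Equiv.neg (ℂ ⧸ gaussInt)).trans
      (Equiv.addRight (((1 / 2 : ℂ) : ℂ ⧸ gaussInt))))
    (hτ2 : τ 2 = (Equiv.neg (ℂ ⧸ gaussInt)).trans
      (Equiv.addRight (((I / 2 : ℂ) : ℂ ⧸ gaussInt))))
    (hτ3 : τ 3 = (Equiv.neg (ℂ ⧸ gaussInt)).trans
      (Equiv.addRight ((((1 + I) / 2 : ℂ) : ℂ ⧸ gaussInt)))) :
    -- each σ_{mn} has order 4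
    (∀ mn ∈ eightPairs, orderOf (σ mn) = 4)
    -- the four pairwise intersections of the cyclic groups G_{mn}
    ∧ Subgroup.zpowers (σ (0, 0)) ⊓ Subgroup.zpowers (σ (2, 2))
        = Subgroup.zpowers (τ 0)
    ∧ Subgroup.zpowers (σ (2, 0)) ⊓ Subgroup.zpowers (σ (0, 2))
        = Subgroup.zpowers (τ 3)
    ∧ Subgroup.zpowers (σ (1, 1)) ⊓ Subgroup.zpowers (σ (3, 3))
        = Subgroup.zpowers (τ 2)
    ∧ Subgroup.zpowers (σ (3, 1)) ⊓ Subgroup.zpowers (σ (1, 3))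
        = Subgroup.zpowers (τ 1)
    -- the squares of the σ_{mn}
    ∧ (σ (0, 0)) ^ 2 = τ 0 ∧ (σ (2, 2)) ^ 2 = τ 0
    ∧ (σ (2, 0)) ^ 2 = τ 3 ∧ (σ (0, 2)) ^ 2 = τ 3
    ∧ (σ (1, 1)) ^ 2 = τ 2 ∧ (σ (3, 3)) ^ 2 = τ 2
    ∧ (σ (3, 1)) ^ 2 = τ 1 ∧ (σ (1, 3)) ^ 2 = τ 1
    -- the eight subgroups G_{mn} are pairwise distinct
    ∧ (∀ mn ∈ eightPairs, ∀ mn' ∈ eightPairs, mn ≠ mn' →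
        Subgroup.zpowers (σ mn) ≠ Subgroup.zpowers (σ mn')) := by
  have hσ' (p : ℤ × ℤ) : σ p = mulIAddPerm (quarterClass p) := hσ p.1 p.2
  have h_not_mem {p q : ℤ × ℤ} (hp : p ∈ eightPairs) (hq : q ∈ eightPairs) (hpq : p ≠ q) :
      σ p ∉ Subgroup.zpowers (σ q) := by
    rw [hσ', hσ']
    exact fun h => hpq (quarterClass_injOn_eightPairs hp hq (eq_of_mulIAddPerm_mem_zpowers h))
  have h00 : σ (0, 0) ^ 2 = τ 0 := by
    rw [hσ']
    exact mulIAddPerm_quarterClass_sq (q := (0, 0)) hτ0 (by simp) (by decide)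
  have h22 : σ (2, 2) ^ 2 = τ 0 := by
    rw [hσ']
    exact mulIAddPerm_quarterClass_sq (q := (0, 0)) hτ0 (by simp) (by decide)
  have h20 : σ (2, 0) ^ 2 = τ 3 := by
    rw [hσ']
    exact mulIAddPerm_quarterClass_sq (q := (2, 2)) hτ3 (by push_cast; ring) (by decide)
  have h02 : σ (0, 2) ^ 2 = τ 3 := by
    rw [hσ']
    exact mulIAddPerm_quarterClass_sq (q := (2, 2)) hτ3 (by push_cast; ring) (by decide)
  have h11 : σ (1, 1) ^ 2 = τ 2 := by
    rw [hσ']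
    exact mulIAddPerm_quarterClass_sq (q := (0, 2)) hτ2 (by push_cast; ring) (by decide)
  have h33 : σ (3, 3) ^ 2 = τ 2 := by
    rw [hσ']
    exact mulIAddPerm_quarterClass_sq (q := (0, 2)) hτ2 (by push_cast; ring) (by decide)
  have h31 : σ (3, 1) ^ 2 = τ 1 := by
    rw [hσ']
    exact mulIAddPerm_quarterClass_sq (q := (2, 0)) hτ1 (by push_cast; ring) (by decide)
  have h13 : σ (1, 3) ^ 2 = τ 1 := by
    rw [hσ']
    exact mulIAddPerm_quarterClass_sq (q := (2, 0)) hτ1 (by push_cast; ring) (by decide)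
  refine ⟨fun p _ => by rw [hσ', orderOf_mulIAddPerm], ?_, ?_, ?_, ?_,
    h00, h22, h20, h02, h11, h33, h31, h13,
    fun p hp q hq hpq h => h_not_mem hp hq hpq (h ▸ Subgroup.mem_zpowers (σ p))⟩
  · exact Subgroup.zpowers_inf_zpowers_of_sq_eq h00 h22
      (h_not_mem (by simp [eightPairs]) (by simp [eightPairs]) (by decide))
  · exact Subgroup.zpowers_inf_zpowers_of_sq_eq h20 h02
      (h_not_mem (by simp [eightPairs]) (by simp [eightPairs]) (by decide))
  · exact Subgroup.zpowers_inf_zpowers_of_sq_eq h11 h33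
      (h_not_mem (by simp [eightPairs]) (by simp [eightPairs]) (by decide))
  · exact Subgroup.zpowers_inf_zpowers_of_sq_eq h31 h13
      (h_not_mem (by simp [eightPairs]) (by simp [eightPairs]) (by decide))
end

section
/- The curve C = V(F₁) ∩ V(F₂) ⊂ ℙ³(ℂ) is smooth: for every nonzero vector v ∈ ℂ⁴ with F₁(v) = F₂(v) = 0, the gradient vectors ∇F₁(v) = (Y, X, −2Z, 0) and ∇F₂(v) = (pZ + 2qX, 4Z, 4Y + pX, −2W) evaluated at v are linearly independent over ℂ. -/
open Complex

/-- With `e₁ e₂ e₃ : ℂ` distinct, summing to zero,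
`p = 4(e₁e₂+e₂e₃+e₃e₁)`, `q = -4e₁e₂e₃`, `F₁ = XY - Z²` and
`F₂ = 4YZ + pXZ + qX² - W²`: the curve `C = V(F₁) ∩ V(F₂) ⊂ ℙ³(ℂ)` is smooth;
for every nonzero vector `v = (X,Y,Z,W)` with `F₁(v) = F₂(v) = 0`, the
gradients `∇F₁(v) = (Y, X, -2Z, 0)` and `∇F₂(v) = (pZ+2qX, 4Z, 4Y+pX, -2W)`
are linearly independent over `ℂ`. -/
theorem stmt_15 (e₁ e₂ e₃ : ℂ) (h12 : e₁ ≠ e₂) (h23 : e₂ ≠ e₃) (h13 : e₁ ≠ e₃)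
    (hsum : e₁ + e₂ + e₃ = 0) (p q : ℂ)
    (hp : p = 4 * (e₁ * e₂ + e₂ * e₃ + e₃ * e₁)) (hq : q = -4 * (e₁ * e₂ * e₃))
    (X Y Z W : ℂ) (hv : ¬ (X = 0 ∧ Y = 0 ∧ Z = 0 ∧ W = 0))
    (h₁ : X * Y - Z ^ 2 = 0)
    (h₂ : 4 * Y * Z + p * X * Z + q * X ^ 2 - W ^ 2 = 0) :
    LinearIndependent ℂ
      ![(![Y, X, -2 * Z, 0] : Fin 4 → ℂ),
        ![p * Z + 2 * q * X, 4 * Z, 4 * Y + p * X, -2 * W]] := by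
  rw [LinearIndependent.pair_iff]
  intro s t hst
  have a₀ : s * Y + t * (p * Z + 2 * q * X) = 0 := by simpa using congrFun hst 0
  have a₁ : s * X + t * (4 * Z) = 0 := by simpa using congrFun hst 1
  have a₂ : s * (-2 * Z) + t * (4 * Y + p * X) = 0 := by simpa using congrFun hst 2
  have a₃ : t * W = 0 := by simpa using congrFun hst 3
  by_cases ht : t = 0
  · subst ht
    refine ⟨?_, rfl⟩
    by_contra hs
    have hY : Y = 0 := by simpa [hs] using a₀
    have hX : X = 0 := by simpa [hs] using a₁
    have hZ : Z = 0 := by simpa [hs] using a₂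
    have hW : W = 0 := by simpa [hX, hY, hZ] using h₂
    exact hv ⟨hX, hY, hZ, hW⟩
  · exfalso
    have hW : W = 0 := by simpa [ht] using a₃
    subst hW
    by_cases hX : X = 0
    · subst hX
      have hZ : Z = 0 := by simpa using h₁
      have hY : Y = 0 := by simpa [hZ, ht] using a₂
      exact hv ⟨rfl, hY, hZ, rfl⟩
    · have hroot : (Z - e₁ * X) * ((Z - e₂ * X) * (Z - e₃ * X)) = 0 := by
        linear_combination (X / 4) * h₂ - Z * h₁ - (X ^ 2 * Z / 4) * hp - (X ^ 3 / 4) * hq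
          - X * Z ^ 2 * hsum
      have hderiv : 12 * Z ^ 2 + p * X ^ 2 = 0 := by
        apply mul_left_cancel₀ ht
        linear_combination X * a₂ + 2 * Z * a₁ - 4 * t * h₁
      have not_double : ∀ a b c : ℂ, a + b + c = 0 → p = 4 * (a * b + b * c + c * a) →
          a ≠ b → a ≠ c → Z - a * X ≠ 0 := by
        intro a b c habc hpabc hab hac hZ
        have h : X ^ 2 * ((a - b) * (a - c)) = 0 := by
          linear_combination hderiv / 4 - 3 * (Z + a * X) * hZ - X ^ 2 / 4 * hpabc
            - 2 * a * X ^ 2 * habc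
        simp [hX, sub_eq_zero, hab, hac] at h
      rcases mul_eq_zero.mp hroot with h | h
      · exact not_double e₁ e₂ e₃ hsum hp h12 h13 h
      · rcases mul_eq_zero.mp h with h | h
        · exact not_double e₂ e₃ e₁ (by linear_combination hsum) (by linear_combination hp)
            h23 h12.symm h
        · exact not_double e₃ e₁ e₂ (by linear_combination hsum) (by linear_combination hp)
            h13.symm h23.symm h
end

section
/- A nonzero vector v = (X,Y,Z,W) ∈ ℂ⁴ satisfies F₁(v) = F₂(v) = 0 if and only if either v is a scalar multiple of (0,1,0,0), or X ≠ 0 and, setting x = Z/X and y = W/X, one has Y/X = x² and y² = 4x³ + px + q. In other words, the map (x,y) ↦ (1 : x² : x : y) is a bijection from the affine curve {y² = 4x³+px+q} ⊂ ℂ² onto C ∖ {(0:1:0:0)}. -/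
open Complex

/-- On the chart `X ≠ 0` the two quadrics cut out the affine Weierstrass curve. -/
lemma quadrics_iff_affine_of_ne_zero {K : Type*} [Field K] {p q X Y Z W : K} (hX : X ≠ 0) :
    (X * Y - Z ^ 2 = 0 ∧ 4 * Y * Z + p * X * Z + q * X ^ 2 - W ^ 2 = 0) ↔
      Y / X = (Z / X) ^ 2 ∧ (W / X) ^ 2 = 4 * (Z / X) ^ 3 + p * (Z / X) + q := by
  obtain ⟨y, rfl⟩ : ∃ y, Y = X * y := ⟨Y / X, by field_simp⟩
  obtain ⟨z, rfl⟩ : ∃ z, Z = X * z := ⟨Z / X, by field_simp⟩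
  obtain ⟨w, rfl⟩ : ∃ w, W = X * w := ⟨W / X, by field_simp⟩
  have hX2 : X ^ 2 ≠ 0 := pow_ne_zero 2 hX
  simp only [mul_div_cancel_left₀ _ hX]
  constructor
  · rintro ⟨h1, h2⟩
    have hy : y = z ^ 2 := mul_left_cancel₀ hX2 (by linear_combination h1)
    subst hy
    exact ⟨rfl, mul_left_cancel₀ hX2 (by linear_combination -h2)⟩
  · rintro ⟨rfl, h⟩
    exact ⟨by ring, by linear_combination -X ^ 2 * h⟩

/-- The plane `X = 0` meets the two quadrics only in the line spanned by `(0,1,0,0)`. -/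
lemma eq_zero_of_quadrics_of_eq_zero {K : Type*} [Field K] {p q X Y Z W : K} (hX : X = 0)
    (h1 : X * Y - Z ^ 2 = 0) (h2 : 4 * Y * Z + p * X * Z + q * X ^ 2 - W ^ 2 = 0) :
    Z = 0 ∧ W = 0 := by
  subst hX
  have hZ : Z = 0 := by simpa using h1
  subst hZ
  exact ⟨rfl, by simpa using h2⟩

/-- With `e₁ e₂ e₃ : ℂ` distinct, summing to zero,
`p = 4(e₁e₂+e₂e₃+e₃e₁)`, `q = -4e₁e₂e₃`, `F₁ = XY - Z²` and
`F₂ = 4YZ + pXZ + qX² - W²`: a nonzero vector `v = (X,Y,Z,W)` satisfies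
`F₁(v) = F₂(v) = 0` iff either `v` is a scalar multiple of `(0,1,0,0)`, or
`X ≠ 0` and, setting `x = Z/X`, `y = W/X`, one has `Y/X = x²` and
`y² = 4x³+px+q`.  In other words `(x,y) ↦ (1:x²:x:y)` is a bijection from the
affine curve `{y² = 4x³+px+q}` onto `C ∖ {(0:1:0:0)}`: every point of the
affine curve maps into `C`, every point of `C` other than `(0:1:0:0)` is
represented by a unique such `(x,y)`. -/
theorem stmt_16 (e₁ e₂ e₃ : ℂ) (h12 : e₁ ≠ e₂) (h23 : e₂ ≠ e₃) (h13 : e₁ ≠ e₃)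
    (hsum : e₁ + e₂ + e₃ = 0) (p q : ℂ)
    (hp : p = 4 * (e₁ * e₂ + e₂ * e₃ + e₃ * e₁)) (hq : q = -4 * (e₁ * e₂ * e₃)) :
    -- characterization of the nonzero vectors on the affine cone over C
    (∀ X Y Z W : ℂ, ¬ (X = 0 ∧ Y = 0 ∧ Z = 0 ∧ W = 0) →
      ((X * Y - Z ^ 2 = 0 ∧ 4 * Y * Z + p * X * Z + q * X ^ 2 - W ^ 2 = 0) ↔
        ((∃ t : ℂ, t ≠ 0 ∧ X = t * 0 ∧ Y = t * 1 ∧ Z = t * 0 ∧ W = t * 0) ∨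
         (X ≠ 0 ∧ Y / X = (Z / X) ^ 2 ∧
           (W / X) ^ 2 = 4 * (Z / X) ^ 3 + p * (Z / X) + q))))
    -- (x,y) ↦ (1:x²:x:y) maps the affine curve into C
    ∧ (∀ x y : ℂ, y ^ 2 = 4 * x ^ 3 + p * x + q →
        (1 * x ^ 2 - x ^ 2 = 0 ∧
          4 * x ^ 2 * x + p * 1 * x + q * 1 ^ 2 - y ^ 2 = 0))
    -- surjectivity onto C ∖ {(0:1:0:0)}
    ∧ (∀ X Y Z W : ℂ, ¬ (X = 0 ∧ Y = 0 ∧ Z = 0 ∧ W = 0) →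
        X * Y - Z ^ 2 = 0 → 4 * Y * Z + p * X * Z + q * X ^ 2 - W ^ 2 = 0 →
        ¬ (∃ t : ℂ, t ≠ 0 ∧ X = t * 0 ∧ Y = t * 1 ∧ Z = t * 0 ∧ W = t * 0) →
        ∃ x y t : ℂ, t ≠ 0 ∧ y ^ 2 = 4 * x ^ 3 + p * x + q ∧
          X = t * 1 ∧ Y = t * x ^ 2 ∧ Z = t * x ∧ W = t * y)
    -- injectivity (up to the scalar in homogeneous coordinates)
    ∧ (∀ x y x' y' t t' : ℂ, t ≠ 0 → t' ≠ 0 →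
        t * 1 = t' * 1 → t * x ^ 2 = t' * x' ^ 2 → t * x = t' * x' →
        t * y = t' * y' → x = x' ∧ y = y') := by
  have at_infinity : ∀ X Y Z W : ℂ, ¬ (X = 0 ∧ Y = 0 ∧ Z = 0 ∧ W = 0) →
      X * Y - Z ^ 2 = 0 → 4 * Y * Z + p * X * Z + q * X ^ 2 - W ^ 2 = 0 → X = 0 →
      ∃ t : ℂ, t ≠ 0 ∧ X = t * 0 ∧ Y = t * 1 ∧ Z = t * 0 ∧ W = t * 0 := by
    intro X Y Z W hv h1 h2 hX
    obtain ⟨hZ, hW⟩ := eq_zero_of_quadrics_of_eq_zero hX h1 h2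
    exact ⟨Y, fun hY => hv ⟨hX, hY, hZ, hW⟩, by simp [hX, hZ, hW]⟩
  refine ⟨fun X Y Z W hv => ⟨?_, ?_⟩, fun x y h => ⟨by ring, by linear_combination -h⟩, ?_, ?_⟩
  · rintro ⟨h1, h2⟩
    by_cases hX : X = 0
    · exact Or.inl (at_infinity X Y Z W hv h1 h2 hX)
    · exact Or.inr ⟨hX, (quadrics_iff_affine_of_ne_zero hX).1 ⟨h1, h2⟩⟩
  · rintro (⟨t, -, rfl, rfl, rfl, rfl⟩ | ⟨hX, h⟩)
    · simp
    · exact (quadrics_iff_affine_of_ne_zero hX).2 h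
  · intro X Y Z W hv h1 h2 hP
    have hX : X ≠ 0 := fun hX => hP (at_infinity X Y Z W hv h1 h2 hX)
    obtain ⟨hy, hw⟩ := (quadrics_iff_affine_of_ne_zero hX).1 ⟨h1, h2⟩
    refine ⟨Z / X, W / X, X, hX, hw, (mul_one X).symm, ?_, ?_, ?_⟩
    · rw [← hy, mul_div_cancel₀ _ hX]
    · rw [mul_div_cancel₀ _ hX]
    · rw [mul_div_cancel₀ _ hX]
  · intro x y x' y' t t' ht _ htt _ hx hy
    obtain rfl : t = t' := by simpa using htt
    exact ⟨mul_left_cancel₀ ht hx, mul_left_cancel₀ ht hy⟩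
end
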